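/- Let f : ℝ → ℝ be continuous, 2π-periodic and strictly positive, and for h ∈ ℤ set γ(h) = ∫_{-π}^{π} f(λ) e^(iλh) dλ (a real number since f is even in the sense γ(-h) = conj γ(h); assume f(λ) = f(-λ) so γ(h) is real). Let Δ_n = [γ(k - j)]_{k,j=1,…,n} be the n×n Toeplitz covariance matrix. Then (1/n) log det Δ_n → (1/(2π)) ∫_{-π}^{π} log( 2π f(λ) ) dλ as n → ∞. -/

import Mathlib

open Real Complex Filter

/-- Schur complement facts. -/
lemma schur_vec {n : ℕ} (M : Matrix (Fin (n+1)) (Fin (n+1)) ℝ) 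
    (d : ℝ) (hd : d = (M.submatrix Fin.succ Fin.succ).det) (hd0 : 0 < d) :
    ∃ v : Fin (n+1) → ℝ, v 0 = 1 ∧ M.mulVec v = Pi.single 0 (M.det / d) := by
  refine ⟨fun i => M.adjugate i 0 / d, ?_, ?_⟩
  · beta_reduce
    rw [Matrix.adjugate_fin_succ_eq_det_submatrix]
    simp only [Fin.succAbove_zero]
    rw [← hd]; simp [hd0.ne']
  · ext i
    have h := congrFun (congrFun (Matrix.mul_adjugate M) i) 0
    simp only [Matrix.mul_apply, Matrix.smul_apply, Matrix.one_apply, smul_eq_mul] at h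
    simp only [Matrix.mulVec, dotProduct, ← mul_div_assoc, ← Finset.sum_div, h, Pi.single_apply]
    split_ifs <;> simp

lemma schur_min {n : ℕ} (M : Matrix (Fin (n+1)) (Fin (n+1)) ℝ) (hM : M.transpose = M)
    (hpsd : ∀ u, 0 ≤ u ⬝ᵥ M.mulVec u)
    (d : ℝ) (hd : d = (M.submatrix Fin.succ Fin.succ).det) (hd0 : 0 < d) :
    (∃ v : Fin (n+1) → ℝ, v 0 = 1 ∧ v ⬝ᵥ M.mulVec v = M.det / d) ∧ 
    ∀ w : Fin (n+1) → ℝ, w 0 = 1 → M.det / d ≤ w ⬝ᵥ M.mulVec w := by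
  obtain ⟨v, hv, hMv⟩ := schur_vec M d hd hd0
  refine ⟨⟨v, hv, by rw [hMv]; simp [hv]⟩, fun w hw => ?_⟩
  have h := hpsd (w - v)
  have h1 : w ⬝ᵥ M.mulVec v = M.det / d := by rw [hMv]; simp [hw]
  have h2 : v ⬝ᵥ M.mulVec v = M.det / d := by rw [hMv]; simp [hv]
  have h3 : v ⬝ᵥ M.mulVec w = M.det / d := by
    rw [Matrix.dotProduct_mulVec, ← Matrix.mulVec_transpose, hM, dotProduct_comm, h1]
  rw [Matrix.mulVec_sub, sub_dotProduct, dotProduct_sub, dotProduct_sub, h1, h2, h3] at h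
  linarith

/-- Point on the unit circle. -/
noncomputable def ez (x : ℝ) : ℂ := Complex.exp (x * Complex.I)

lemma ez_cont : Continuous ez := by unfold ez; fun_prop
lemma norm_ez (x : ℝ) : ‖ez x‖ = 1 := Complex.norm_exp_ofReal_mul_I x
lemma ez_re (x : ℝ) : (ez x).re = Real.cos x := Complex.exp_ofReal_mul_I_re x
lemma ez_im (x : ℝ) : (ez x).im = Real.sin x := Complex.exp_ofReal_mul_I_im x

open Polynomial in
lemma cos_poly (P : ℝ[X]) : ∃ R : ℝ[X], ∀ x : ℝ, P.eval (Real.cos x) = (aeval (ez x) R).re := by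
  induction P using Polynomial.induction_on with
  | C a => exact ⟨C a, fun x => by simp⟩
  | add p q hp hq =>
    obtain ⟨R, hR⟩ := hp
    obtain ⟨S, hS⟩ := hq
    exact ⟨R + S, fun x => by simp [hR, hS]⟩
  | monomial n a h =>
    obtain ⟨R, hR⟩ := h
    refine ⟨C (R.coeff 0) * X + C (1/2) * (X ^ 2 * R.divX + R.divX), fun x => ?_⟩
    have h1 : (C a * X ^ (n+1) : ℝ[X]).eval (Real.cos x) = Real.cos x * (aeval (ez x) R).re := by
      rw [← hR]; simp; ring
    rw [h1]
    conv_lhs => rw [← Polynomial.divX_mul_X_add R]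
    have e1 := ez_re x
    have e2 := ez_im x
    have e3 := Real.sin_sq_add_cos_sq x
    simp only [map_add, map_mul, aeval_X, aeval_C, map_pow]
    generalize aeval (ez x) R.divX = s
    generalize ez x = z at *
    simp only [Complex.add_re, Complex.mul_re, Complex.mul_im, Complex.coe_algebraMap, Complex.ofReal_re, Complex.ofReal_im, pow_two, Complex.add_im, e1, e2]
    linear_combination (s.re / 2) * e3

lemma mean_entire (F : ℂ → ℂ) (hF : Differentiable ℂ F) :
    ∫ x in (-π)..π, (F (ez x)).re = 2 * π * (F 0).re := by
  have hc : Continuous F := hF.continuous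
  have hez := ez_cont
  have hp : Function.Periodic (fun x : ℝ => F (ez x)) (2 * π) := by
    intro x
    have : ez (x + 2 * π) = ez x := by
      unfold ez
      push_cast
      rw [add_mul, Complex.exp_add, Complex.exp_two_pi_mul_I, mul_one]
    simp only [this]
  have h1 : Real.circleAverage F 0 1 = F 0 := DiffContOnCl.circleAverage hF.diffContOnCl
  have h2 : ∫ x in (-π)..π, F (ez x) = ∫ x in (0:ℝ)..(2 * π), F (circleMap 0 1 x) := by
    have := hp.intervalIntegral_add_eq (-π) 0
    rw [show -π + 2 * π = π by ring, zero_add] at this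
    rw [this]
    congr 1; ext x; simp [circleMap, ez]
  have h3 : ∫ x in (-π)..π, F (ez x) = ((2 * π : ℝ) : ℂ) * F 0 := by
    rw [h2, ← h1, Real.circleAverage_def, ← Complex.real_smul, smul_smul, mul_inv_cancel₀ (by positivity), one_smul]
  have h4 := congrArg Complex.re h3
  rw [Complex.re_ofReal_mul, ← Complex.reCLM_apply, ← ContinuousLinearMap.intervalIntegral_comp_comm] at h4
  · exact h4
  · apply Continuous.intervalIntegrable; fun_prop

open Polynomial in
lemma approx (f : ℝ → ℝ) (hf : Continuous f)
    (hper : Function.Periodic f (2 * π)) (heven : ∀ x, f (-x) = f x) (ε : ℝ) (hε : 0 < ε) :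
    ∃ R : ℝ[X], ∀ x, |(aeval (ez x) R).re - f x| < ε := by
  obtain ⟨P, hP⟩ := exists_polynomial_near_of_continuousOn (-1) 1 (fun t => f (Real.arccos t))
    (hf.comp Real.continuous_arccos).continuousOn ε hε
  obtain ⟨R, hR⟩ := cos_poly P
  refine ⟨R, fun x => ?_⟩
  have h := hP (Real.cos x) ⟨Real.neg_one_le_cos x, Real.cos_le_one x⟩
  rw [hR] at h
  have : f (Real.arccos (Real.cos x)) = f x := by
    have h2 : Real.cos (Real.arccos (Real.cos x)) = Real.cos x := 
      Real.cos_arccos (Real.neg_one_le_cos x) (Real.cos_le_one x)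
    rw [Real.cos_eq_cos_iff] at h2
    generalize Real.arccos (Real.cos x) = y at h2 ⊢
    obtain ⟨k, hk | hk⟩ := h2
    · rw [hk]
      have := (hper.int_mul k) y
      rw [← this]; congr 1; ring
    · rw [hk]
      have := (hper.int_mul k) (-y)
      rw [← heven, ← this]; congr 1; ring
  rwa [this] at h

open Polynomial in
lemma quad (f : ℝ → ℝ) (hf : Continuous f) (γ : ℤ → ℝ)
    (hγ : ∀ h : ℤ, (γ h : ℂ) =
      ∫ x in (-π)..π, (f x : ℂ) * Complex.exp (Complex.I * (x : ℂ) * (h : ℂ))) (n : ℕ) (v : Fin n → ℝ) :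
    v ⬝ᵥ (Matrix.of fun k j : Fin n => γ (((k : ℕ) : ℤ) - ((j : ℕ) : ℤ))).mulVec v = 
      ∫ x in (-π)..π, f x * Complex.normSq (aeval (ez x) (∑ k : Fin n, C (v k) * X ^ (k:ℕ))) := by
  have hg : ∀ h : ℤ, γ h = ∫ x in (-π)..π, f x * Real.cos (h * x) := by
    intro h
    have h1 := congrArg Complex.re (hγ h)
    rw [Complex.ofReal_re] at h1
    rw [h1, ← Complex.reCLM_apply, ← ContinuousLinearMap.intervalIntegral_comp_comm]
    · congr 1; ext x
      rw [Complex.reCLM_apply, Complex.re_ofReal_mul]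
      have : Complex.I * x * h = ((h * x : ℝ) : ℂ) * Complex.I := by push_cast; ring
      rw [this, Complex.exp_ofReal_mul_I_re]
    · apply Continuous.intervalIntegrable; fun_prop
  have key : ∀ x, f x * Complex.normSq (aeval (ez x) (∑ k : Fin n, C (v k) * X ^ (k:ℕ))) = 
      ∑ k : Fin n, ∑ j : Fin n, v k * v j * (f x * Real.cos ((((k:ℕ):ℤ) - ((j:ℕ):ℤ) : ℤ) * x)) := by
    intro x
    have e : ∀ k : ℕ, ez x ^ k = Complex.exp ((k * x : ℝ) * Complex.I) := by
      intro k; rw [ez, ← Complex.exp_nat_mul]; congr 1; push_cast; ring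
    rw [Complex.normSq_apply]
    simp only [map_sum, map_mul, aeval_C, aeval_X, map_pow, Complex.re_sum, Complex.im_sum, e, Complex.coe_algebraMap, Complex.re_ofReal_mul, Complex.im_ofReal_mul, Complex.exp_ofReal_mul_I_re, Complex.exp_ofReal_mul_I_im]
    rw [Finset.sum_mul_sum, Finset.sum_mul_sum, ← Finset.sum_add_distrib, Finset.mul_sum]
    refine Finset.sum_congr rfl fun k _ => ?_
    rw [← Finset.sum_add_distrib, Finset.mul_sum]
    refine Finset.sum_congr rfl fun j _ => ?_
    push_cast
    rw [sub_mul, Real.cos_sub]; ring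
  simp_rw [key]
  rw [intervalIntegral.integral_finsetSum]
  · simp only [dotProduct, Matrix.mulVec, Finset.mul_sum, Matrix.of_apply]
    refine Finset.sum_congr rfl fun k _ => ?_
    rw [intervalIntegral.integral_finsetSum]
    · refine Finset.sum_congr rfl fun j _ => ?_
      rw [intervalIntegral.integral_const_mul, hg]; ring
    · intro j _; apply Continuous.intervalIntegrable; fun_prop
  · intro j _; apply Continuous.intervalIntegrable; fun_prop

open Polynomial in
lemma aeval_zero_re (R : ℝ[X]) : aeval (0:ℂ) R = (R.coeff 0 : ℂ) := by
  rw [← Polynomial.coeff_zero_eq_aeval_zero']; rfl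

open Polynomial in
lemma aeval_diff (R : ℝ[X]) : Differentiable ℂ (fun z : ℂ => aeval z R) := R.differentiable_aeval

lemma normSq_exp (w : ℂ) : Complex.normSq (Complex.exp w) = Real.exp (2 * w.re) := by
  rw [Complex.normSq_eq_norm_sq, Complex.norm_exp, ← Real.exp_nat_mul]; norm_num

open Polynomial in
lemma lower (f : ℝ → ℝ) (hf : Continuous f) (hpos : ∀ x, 0 < f x) (R : ℝ[X]) (ε : ℝ)
    (hR : ∀ x, |(aeval (ez x) R).re - Real.log (2 * π * f x)| < ε) (P : ℝ[X]) (hP : P.coeff 0 = 1) :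
    Real.exp (R.coeff 0 - ε) ≤ ∫ x in (-π)..π, f x * Complex.normSq (aeval (ez x) P) := by
  have hez := ez_cont
  set c := R.coeff 0 with hc
  let F : ℂ → ℂ := fun z => aeval z P * Complex.exp ((aeval z R - c) / 2)
  have hdF : Differentiable ℂ F := by
    have h1 := aeval_diff P
    have h2 := aeval_diff R
    fun_prop
  have hF0 : F 0 = 1 := by simp [F, aeval_zero_re, hP, ← hc]
  have hm := mean_entire F hdF
  have hFc := hdF.continuous
  have hPc := (aeval_diff P).continuous
  rw [hF0, Complex.one_re, mul_one] at hm
  have hpt : ∀ x, Real.exp (c - ε) / (2 * π) * (2 * (F (ez x)).re - 1) ≤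
      f x * Complex.normSq (aeval (ez x) P) := by
    intro x
    have h1 : Real.exp ((aeval (ez x) R).re - ε) ≤ 2 * π * f x := by
      rw [← Real.le_log_iff_exp_le (by have := hpos x; positivity)]
      linarith [(abs_lt.1 (hR x)).2]
    have h2 : Complex.normSq (F (ez x)) =
        Complex.normSq (aeval (ez x) P) * Real.exp ((aeval (ez x) R).re - c) := by
      simp only [F, map_mul, normSq_exp]
      congr 2
      rw [show ((aeval (ez x) R - (c:ℂ)) / 2) = ((1/2 : ℝ) : ℂ) * (aeval (ez x) R - (c:ℂ)) by push_cast; ring, Complex.re_ofReal_mul]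
      simp
    have h3 : 2 * (F (ez x)).re - 1 ≤ Complex.normSq (F (ez x)) := by
      rw [Complex.normSq_apply]; nlinarith [sq_nonneg ((F (ez x)).re - 1), sq_nonneg (F (ez x)).im]
    have h4 : Real.exp ((aeval (ez x) R).re - ε) = Real.exp (c - ε) * Real.exp ((aeval (ez x) R).re - c) := by
      rw [← Real.exp_add]; congr 1; ring
    calc _ ≤ Real.exp (c - ε) / (2 * π) * Complex.normSq (F (ez x)) := by gcongr
      _ = Real.exp ((aeval (ez x) R).re - ε) / (2 * π) * Complex.normSq (aeval (ez x) P) := by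
        rw [h2, h4]; ring
      _ ≤ _ := by
        gcongr
        · exact Complex.normSq_nonneg _
        · rw [div_le_iff₀ (by positivity)]; linarith
  have hns := Complex.continuous_normSq
  calc Real.exp (c - ε) = ∫ x in (-π)..π, Real.exp (c - ε) / (2 * π) * (2 * (F (ez x)).re - 1) := by
        rw [intervalIntegral.integral_const_mul, intervalIntegral.integral_sub, intervalIntegral.integral_const_mul, hm]
        · simp; field_simp; ring
        · apply Continuous.intervalIntegrable; fun_prop
        · apply Continuous.intervalIntegrable; fun_prop
    _ ≤ _ := by
      apply intervalIntegral.integral_mono_on (by linarith [Real.pi_pos])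
      · apply Continuous.intervalIntegrable; fun_prop
      · apply Continuous.intervalIntegrable; fun_prop
      · intro x _; exact hpt x

open Polynomial in
lemma upper (f : ℝ → ℝ) (hf : Continuous f) (hpos : ∀ x, 0 < f x) (R : ℝ[X]) (ε : ℝ) (hε : 0 < ε)
    (hR : ∀ x, |(aeval (ez x) R).re - Real.log (2 * π * f x)| < ε) : ∃ P : ℝ[X], P.coeff 0 = 1 ∧
     ∫ x in (-π)..π, f x * Complex.normSq (aeval (ez x) P) ≤ Real.exp (R.coeff 0 + 2 * ε) := by
  have hez := ez_cont
  have hns := Complex.continuous_normSq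
  set c := R.coeff 0 with hc
  let Q : ℝ[X] := C (1/2) * (C c - R)
  have hQ0 : Q.coeff 0 = 0 := by simp [Q, hc]
  have hQre : ∀ x, 2 * (aeval (ez x) Q).re = c - (aeval (ez x) R).re := by
    intro x
    simp only [Q, map_mul, aeval_C, map_sub, Complex.coe_algebraMap, Complex.re_ofReal_mul, Complex.sub_re, Complex.ofReal_re]
    ring
  have hQc := (aeval_diff Q).continuous
  let p : ℕ → ℝ[X] := fun K => ∑ k ∈ Finset.range K, C ((k.factorial : ℝ)⁻¹) * Q ^ k
  have hpe : ∀ K z, aeval z (p K) = ∑ k ∈ Finset.range K, (aeval z Q) ^ k / (k.factorial : ℂ) := by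
    intro K z
    simp only [p, map_sum, map_mul, aeval_C, map_pow, Complex.coe_algebraMap]
    refine Finset.sum_congr rfl fun k _ => ?_
    push_cast; ring
  have hp0 : ∀ K, (p (K+1)).coeff 0 = 1 := by
    intro K
    have : ∀ z : ℝ[X], z.coeff 0 = z.eval 0 := fun z => Polynomial.coeff_zero_eq_eval_zero z
    rw [this] at hQ0 ⊢
    simp only [p, Polynomial.eval_finsetSum, eval_mul, eval_C, eval_pow, hQ0]
    rw [Finset.sum_range_succ']
    simp
  have hlim : Tendsto (fun K => ∫ x in (-π)..π, f x * Complex.normSq (aeval (ez x) (p K))) atTop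
      (nhds (∫ x in (-π)..π, f x * Complex.normSq (Complex.exp (aeval (ez x) Q)))) := by
    apply intervalIntegral.tendsto_integral_filter_of_dominated_convergence
      (fun x => f x * (Real.exp ‖aeval (ez x) Q‖) ^ 2)
    · refine Eventually.of_forall fun K => ?_
      have hPc := (aeval_diff (p K)).continuous
      apply Continuous.aestronglyMeasurable; fun_prop
    · refine Eventually.of_forall fun K => Eventually.of_forall fun x _ => ?_
      rw [norm_mul, Real.norm_of_nonneg (hpos x).le, Real.norm_of_nonneg (Complex.normSq_nonneg _), Complex.normSq_eq_norm_sq]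
      have := (hpos x).le
      gcongr
      rw [hpe]
      refine (norm_sum_le _ _).trans ?_
      simp only [norm_div, norm_pow, Complex.norm_natCast]
      exact Real.sum_le_exp_of_nonneg (norm_nonneg _) K
    · apply Continuous.intervalIntegrable; fun_prop
    · refine Eventually.of_forall fun x _ => ?_
      refine Tendsto.const_mul _ ((hns.tendsto _).comp ?_)
      simp only [hpe]
      have := (NormedSpace.expSeries_div_hasSum_exp (aeval (ez x) Q)).tendsto_sum_nat
      rwa [← Complex.exp_eq_exp_ℂ] at this
  have hle : ∫ x in (-π)..π, f x * Complex.normSq (Complex.exp (aeval (ez x) Q)) ≤ Real.exp (c + ε) := by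
    calc _ ≤ ∫ x in (-π)..π, Real.exp (c + ε) / (2 * π) := by
          apply intervalIntegral.integral_mono_on (by linarith [Real.pi_pos])
          · apply Continuous.intervalIntegrable; fun_prop
          · apply Continuous.intervalIntegrable; fun_prop
          · intro x _
            rw [normSq_exp, hQre, le_div_iff₀ (by positivity)]
            have h1 : 2 * π * f x ≤ Real.exp ((aeval (ez x) R).re + ε) := by
              rw [← Real.log_le_iff_le_exp (by have := hpos x; positivity)]
              linarith [(abs_lt.1 (hR x)).1]
            calc _ = (2 * π * f x) * Real.exp (c - (aeval (ez x) R).re) := by ring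
              _ ≤ Real.exp ((aeval (ez x) R).re + ε) * Real.exp (c - (aeval (ez x) R).re) := by gcongr
              _ = _ := by rw [← Real.exp_add]; congr 1; ring
      _ = _ := by
          simp; field_simp; ring
  have hlt : Real.exp (c + ε) < Real.exp (c + 2 * ε) := Real.exp_lt_exp.2 (by linarith)
  have hev := ((tendsto_add_atTop_iff_nat 1).2 hlim).eventually_le_const (lt_of_le_of_lt hle hlt)
  obtain ⟨K, hK⟩ := hev.exists
  exact ⟨p (K+1), hp0 K, hK⟩

/-- Szegő-type limit underlying the Whittle approximation: for a
continuous, `2π`-periodic, strictly positive, even spectral density `f` with Fourier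
coefficients `γ(h) = ∫_{-π}^{π} f(λ)e^(iλh) dλ` (real by evenness) and Toeplitz
covariance matrices `Δ_n = [γ(k-j)]`, we have
`(1/n) log det Δ_n → (1/2π) ∫_{-π}^{π} log(2π f(λ)) dλ`. -/
theorem szego_limit_log_det_toeplitz (f : ℝ → ℝ) (hf : Continuous f)
    (hper : Function.Periodic f (2 * π)) (hpos : ∀ x, 0 < f x)
    (heven : ∀ x, f (-x) = f x) (γ : ℤ → ℝ)
    (hγ : ∀ h : ℤ, (γ h : ℂ) =
      ∫ x in (-π)..π, (f x : ℂ) * Complex.exp (Complex.I * (x : ℂ) * (h : ℂ))) :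
    Tendsto (fun n : ℕ =>
        (1 / (n : ℝ)) *
          Real.log (Matrix.det (Matrix.of fun k j : Fin n => γ (((k : ℕ) : ℤ) - ((j : ℕ) : ℤ)))))
      atTop (nhds ((1 / (2 * π)) * ∫ x in (-π)..π, Real.log (2 * π * f x))) := by
  let T : (n : ℕ) → Matrix (Fin n) (Fin n) ℝ := fun n =>
    Matrix.of fun k j : Fin n => γ (((k : ℕ) : ℤ) - ((j : ℕ) : ℤ))
  let D : ℕ → ℝ := fun n => (T n).det
  set L := (1 / (2 * π)) * ∫ x in (-π)..π, Real.log (2 * π * f x) with hL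
  have hez := ez_cont
  have hlogc : Continuous fun x => Real.log (2 * π * f x) :=
    Continuous.log (by fun_prop) (fun x => by have := hpos x; positivity)
  -- good approximations
  have happ : ∀ ε > 0, ∃ R : Polynomial ℝ,
      (∀ x, |(Polynomial.aeval (ez x) R).re - Real.log (2 * π * f x)| < ε) ∧ |R.coeff 0 - L| ≤ ε := by
    intro ε hε
    obtain ⟨R, hR⟩ := approx (fun x => Real.log (2 * π * f x)) hlogc
      (fun x => by simp only [hper x]) (fun x => by simp only [heven x]) ε hε
    refine ⟨R, hR, ?_⟩
    have hRc := (aeval_diff R).continuous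
    have hm := mean_entire _ (aeval_diff R)
    rw [aeval_zero_re, Complex.ofReal_re] at hm
    have h1 : R.coeff 0 - L = (1 / (2 * π)) * ∫ x in (-π)..π, ((Polynomial.aeval (ez x) R).re - Real.log (2 * π * f x)) := by
      rw [intervalIntegral.integral_sub, hm, hL]
      · field_simp
      · apply Continuous.intervalIntegrable; fun_prop
      · exact hlogc.intervalIntegrable _ _
    have h2 := intervalIntegral.norm_integral_le_of_norm_le_const (a := -π) (b := π)
      (f := fun x => (Polynomial.aeval (ez x) R).re - Real.log (2 * π * f x)) (C := ε) (fun x _ => (hR x).le)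
    rw [Real.norm_eq_abs] at h2
    rw [h1, abs_mul, abs_of_pos (by positivity)]
    rw [show π - -π = 2 * π by ring, abs_of_pos (by positivity : 0 < 2 * π)] at h2
    rw [one_div, inv_mul_le_iff₀ (by positivity)]
    linarith
  have hsymm : ∀ n, (T n).transpose = T n := by
    intro n
    have hg : ∀ h : ℤ, γ (-h) = γ h := by
      intro h
      have : ((γ (-h) : ℝ) : ℂ) = (γ h : ℝ) := by
        rw [hγ, hγ]
        have := intervalIntegral.integral_comp_neg (a := -π) (b := π) 
          (fun x => (f x : ℂ) * Complex.exp (Complex.I * (x : ℂ) * (h : ℂ)))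
        rw [neg_neg] at this
        rw [← this]
        congr 1; ext x
        rw [heven]; push_cast; ring_nf
      exact_mod_cast this
    ext i j
    simp only [T, Matrix.transpose_apply, Matrix.of_apply]
    rw [← hg, neg_sub]
  have hpsd : ∀ n u, 0 ≤ u ⬝ᵥ (T n).mulVec u := by
    intro n u
    rw [quad f hf γ hγ n u]
    apply intervalIntegral.integral_nonneg (by linarith [Real.pi_pos])
    intro x _
    exact mul_nonneg (hpos x).le (Complex.normSq_nonneg _)
  have hsub : ∀ n, D n = ((T (n+1)).submatrix Fin.succ Fin.succ).det := by
    intro n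
    simp only [D]
    congr 1
    ext i j
    simp [T]
  have hlow : ∀ n, 0 < D n → ∀ (R : Polynomial ℝ) (ε : ℝ),
      (∀ x, |(Polynomial.aeval (ez x) R).re - Real.log (2 * π * f x)| < ε) → 
      Real.exp (R.coeff 0 - ε) ≤ D (n+1) / D n := by
    intro n hn R ε hR
    obtain ⟨v, hv, hv2⟩ := (schur_min (T (n+1)) (hsymm _) (hpsd _) (D n) (hsub n) hn).1
    change _ ≤ (T (n+1)).det / D n
    rw [← hv2, quad f hf γ hγ]
    apply lower f hf hpos R ε hR
    rw [Polynomial.finsetSum_coeff, Finset.sum_eq_single 0]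
    · simp [hv]
    · intro b _ hb
      rw [Polynomial.coeff_C_mul_X_pow, if_neg]
      intro h; apply hb; ext; exact h.symm
    · simp
  have hDpos : ∀ n, 0 < D n := by
    intro n
    induction n with
    | zero => simp [D]
    | succ n ih =>
      obtain ⟨R, hR, -⟩ := happ 1 one_pos
      have := lt_of_lt_of_le (Real.exp_pos _) (hlow n ih R 1 hR)
      exact (div_pos_iff_of_pos_right ih).1 this
  have hr : Tendsto (fun n => Real.log (D (n+1)) - Real.log (D n)) atTop (nhds L) := by
    rw [Metric.tendsto_atTop]
    intro ε hε
    obtain ⟨R, hR, hRL⟩ := happ (ε / 4) (by positivity)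
    obtain ⟨P, hP0, hP⟩ := upper f hf hpos R (ε / 4) (by positivity) hR
    refine ⟨P.natDegree, fun n hn => ?_⟩
    have hup : D (n+1) / D n ≤ Real.exp (R.coeff 0 + 2 * (ε / 4)) := by
      have h := (schur_min (T (n+1)) (hsymm _) (hpsd _) (D n) (hsub n) (hDpos n)).2
        (fun k => P.coeff k) (by simpa using hP0)
      rw [quad f hf γ hγ, Fin.sum_univ_eq_sum_range (fun k => Polynomial.C (P.coeff k) * Polynomial.X ^ k),
        ← Polynomial.as_sum_range_C_mul_X_pow' P (Nat.lt_succ_of_le hn)] at h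
      exact h.trans hP
    have hlo := hlow n (hDpos n) R _ hR
    have hq : 0 < D (n+1) / D n := div_pos (hDpos _) (hDpos _)
    rw [← Real.log_div (hDpos _).ne' (hDpos _).ne']
    rw [← Real.log_le_iff_le_exp hq] at hup
    rw [← Real.le_log_iff_exp_le hq] at hlo
    rw [Real.dist_eq, abs_lt]
    rw [abs_le] at hRL
    constructor <;> linarith [hRL.1, hRL.2]
  have hces := hr.cesaro
  refine hces.congr fun n => ?_
  rw [Finset.sum_range_sub (fun n => Real.log (D n)), one_div]
  simp [D, T]
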